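/- For all integers m, n with n ≠ 0 (so that F(n) ≠ 0) and every nonnegative integer k: ∑_{j=0}^{k} ∑_{s=0}^{j} (-1)^{n·(j+s)+s} · C(k,j) · C(j,s) · G(m+2k−(n+1)·j+2n·s) / F(n)^j = (-1)^k · G(m), where C(k,j) denotes the binomial coefficient. -/

import Mathlib

/-- A two-sided sequence satisfying the Fibonacci recurrence is determined by its values at
`0` and `1`. -/
theorem eq_of_fib_recurrence {u v : ℤ → ℝ}
    (hu : ∀ m : ℤ, u m = u (m - 1) + u (m - 2))
    (hv : ∀ m : ℤ, v m = v (m - 1) + v (m - 2))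
    (h0 : u 0 = v 0) (h1 : u 1 = v 1) (m : ℤ) : u m = v m := by
  suffices h : u m = v m ∧ u (m + 1) = v (m + 1) from h.1
  induction m using Int.induction_on with
  | zero => exact ⟨h0, by simpa using h1⟩
  | succ i ih =>
    refine ⟨ih.2, ?_⟩
    rw [hu, hv, show (i : ℤ) + 1 + 1 - 1 = i + 1 by ring,
      show (i : ℤ) + 1 + 1 - 2 = i by ring, ih.1, ih.2]
  | pred i ih =>
    have hu' := hu (-i + 1)
    have hv' := hv (-i + 1)
    rw [show -(i : ℤ) + 1 - 1 = -i by ring, show -(i : ℤ) + 1 - 2 = -i - 1 by ring] at hu' hv'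
    rw [show -(i : ℤ) - 1 + 1 = -i by ring]
    exact ⟨by linarith [ih.1, ih.2], ih.1⟩

/-- The powers of a root of `X ^ 2 - X - 1` satisfy the Fibonacci recurrence. -/
theorem zpow_fib_recurrence {x : ℝ} (hx0 : x ≠ 0) (hx : x ^ 2 = x + 1) (m : ℤ) :
    x ^ m = x ^ (m - 1) + x ^ (m - 2) := by
  have h1 : x ^ m = x ^ (m - 2) * x ^ 2 := by
    rw [← zpow_natCast x 2, ← zpow_add₀ hx0]; congr 1; push_cast; ring
  have h2 : x ^ (m - 1) = x ^ (m - 2) * x := by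
    rw [← zpow_add_one₀ hx0]; congr 1; ring
  rw [h1, h2, hx]; ring

/-- The Binet formula for the Fibonacci numbers, for two roots `x`, `y` of `X ^ 2 - X - 1`. -/
theorem zpow_sub_zpow_eq_fib_mul {F : ℤ → ℝ} (hF0 : F 0 = 0) (hF1 : F 1 = 1)
    (hF : ∀ m : ℤ, F m = F (m - 1) + F (m - 2)) {x y : ℝ} (hx0 : x ≠ 0) (hy0 : y ≠ 0)
    (hx : x ^ 2 = x + 1) (hy : y ^ 2 = y + 1) (n : ℤ) :
    x ^ n - y ^ n = F n * (x - y) := by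
  refine eq_of_fib_recurrence (u := fun n => x ^ n - y ^ n) (v := fun n => F n * (x - y))
    (fun m => ?_) (fun m => ?_) (by simp [hF0]) (by simp [hF1]) n
  · rw [zpow_fib_recurrence hx0 hx m, zpow_fib_recurrence hy0 hy m]; ring
  · rw [hF m]; ring

/-- The Binet formula for generalized Fibonacci sequences. -/
theorem exists_eq_goldenRatio_zpow {G : ℤ → ℝ}
    (hG : ∀ m : ℤ, G m = G (m - 1) + G (m - 2)) :
    ∃ a b : ℝ, ∀ m : ℤ, G m = a * Real.goldenRatio ^ m + b * Real.goldenConj ^ m := by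
  have h5 : Real.goldenRatio - Real.goldenConj ≠ 0 := by
    rw [Real.goldenRatio_sub_goldenConj]; positivity
  refine ⟨(G 1 - G 0 * Real.goldenConj) / (Real.goldenRatio - Real.goldenConj),
    (G 0 * Real.goldenRatio - G 1) / (Real.goldenRatio - Real.goldenConj),
    eq_of_fib_recurrence hG (fun m => ?_) ?_ ?_⟩
  · rw [zpow_fib_recurrence Real.goldenRatio_ne_zero Real.goldenRatio_sq m,
      zpow_fib_recurrence Real.goldenConj_ne_zero Real.goldenConj_sq m]
    ring
  · simp only [zpow_zero]; field_simp; ring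
  · simp only [zpow_one]; field_simp; ring

/-- The Fibonacci numbers of nonzero integer index do not vanish. -/
theorem fib_int_ne_zero {F : ℤ → ℝ} (hF0 : F 0 = 0) (hF1 : F 1 = 1)
    (hF : ∀ m : ℤ, F m = F (m - 1) + F (m - 2)) {n : ℤ} (hn : n ≠ 0) : F n ≠ 0 := by
  intro h
  have hB := zpow_sub_zpow_eq_fib_mul hF0 hF1 hF Real.goldenRatio_ne_zero
    Real.goldenConj_ne_zero Real.goldenRatio_sq Real.goldenConj_sq n
  rw [h, zero_mul, sub_eq_zero, ← neg_neg Real.goldenConj, ← Real.inv_goldenRatio] at hB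
  have habs := congrArg abs hB
  rw [abs_zpow, abs_zpow, abs_neg, abs_inv, abs_of_pos Real.goldenRatio_pos, inv_zpow',
    zpow_right_inj₀ Real.goldenRatio_pos Real.one_lt_goldenRatio.ne'] at habs
  omega

/-- The double binomial sum for the sequence of powers of a root of `X ^ 2 - X - 1`. -/
theorem double_binomial_sum_zpow {F : ℤ → ℝ} (hF0 : F 0 = 0) (hF1 : F 1 = 1)
    (hF : ∀ m : ℤ, F m = F (m - 1) + F (m - 2)) {x : ℝ} (hx0 : x ≠ 0) (hx : x ^ 2 = x + 1)
    (m : ℤ) {n : ℤ} (hn : n ≠ 0) (k : ℕ) :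
    ∑ j ∈ Finset.range (k + 1), ∑ s ∈ Finset.range (j + 1),
        (-1 : ℝ) ^ (n * ((j : ℤ) + s) + s) * (Nat.choose k j : ℝ)
          * (Nat.choose j s : ℝ)
          * x ^ (m + 2 * k - (n + 1) * j + 2 * n * s) / F n ^ j
      = (-1 : ℝ) ^ k * x ^ m := by
  have hFn := fib_int_ne_zero hF0 hF1 hF hn
  have hbase : (-(x * x ^ n) + (-1) ^ n * x ^ (1 - n)) / F n + x ^ 2 = -1 := by
    have hy : (-x⁻¹) ^ 2 = -x⁻¹ + 1 := by
      field_simp; linarith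
    have hB := zpow_sub_zpow_eq_fib_mul hF0 hF1 hF hx0 (neg_ne_zero.2 (inv_ne_zero hx0)) hx hy n
    have hyn : (-1 : ℝ) ^ n * x ^ (1 - n) = x * (-x⁻¹) ^ n := by
      rw [← neg_one_mul x⁻¹, mul_zpow, inv_zpow', sub_eq_add_neg, zpow_add₀ hx0, zpow_one]; ring
    rw [hyn, show -(x * x ^ n) + x * (-x⁻¹) ^ n = -(x * (x ^ n - (-x⁻¹) ^ n)) by ring, hB]
    field_simp
    ring
  rw [← congrArg (· ^ k) hbase, add_pow, Finset.sum_mul]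
  refine Finset.sum_congr rfl fun j hj => ?_
  rw [div_pow, add_pow, Finset.sum_div, Finset.sum_mul, Finset.sum_mul, Finset.sum_mul]
  refine Finset.sum_congr rfl fun s hs => ?_
  obtain ⟨t, rfl⟩ := Nat.exists_eq_add_of_le (Nat.lt_succ_iff.1 (Finset.mem_range.1 hs))
  obtain ⟨r, rfl⟩ := Nat.exists_eq_add_of_le (Nat.lt_succ_iff.1 (Finset.mem_range.1 hj))
  rw [Nat.add_sub_cancel_left, Nat.add_sub_cancel_left]
  have hsign : (-1 : ℝ) ^ (n * (((s + t : ℕ) : ℤ) + s) + s) = (-1) ^ s * ((-1) ^ n) ^ t := by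
    have h1 : (-1 : ℝ) ≠ 0 := by norm_num
    rw [show n * (((s + t : ℕ) : ℤ) + s) + s = 2 * (n * s) + (s + n * t) by push_cast; ring,
      zpow_add₀ h1, zpow_add₀ h1, zpow_mul, zpow_mul (-1) n, zpow_natCast, zpow_natCast]
    norm_num
  have hpow : x ^ (m + 2 * ((s + t + r : ℕ) : ℤ) - (n + 1) * ((s + t : ℕ) : ℤ) + 2 * n * s)
      = (x * x ^ n) ^ s * (x ^ (1 - n)) ^ t * (x ^ 2) ^ r * x ^ m := by
    rw [← zpow_one_add₀ hx0, ← zpow_natCast x 2]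
    simp only [← zpow_natCast (x ^ (_ : ℤ)), ← zpow_mul, ← zpow_add₀ hx0]
    congr 1
    push_cast
    ring
  rw [hsign, hpow, neg_pow (x * x ^ n), mul_pow ((-1) ^ n)]
  ring

/-- Weighted double binomial sum identity for generalized Fibonacci sequences. -/
theorem stmt_10 (F G : ℤ → ℝ)
    (hF0 : F 0 = 0) (hF1 : F 1 = 1)
    (hF : ∀ m : ℤ, F m = F (m - 1) + F (m - 2))
    (hG : ∀ m : ℤ, G m = G (m - 1) + G (m - 2))
    (m n : ℤ) (hn : n ≠ 0) (k : ℕ) :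
    ∑ j ∈ Finset.range (k + 1), ∑ s ∈ Finset.range (j + 1),
        (-1 : ℝ) ^ (n * ((j : ℤ) + s) + s) * (Nat.choose k j : ℝ)
          * (Nat.choose j s : ℝ)
          * G (m + 2 * k - (n + 1) * j + 2 * n * s) / F n ^ j
      = (-1 : ℝ) ^ k * G m := by
  obtain ⟨a, b, hab⟩ := exists_eq_goldenRatio_zpow hG
  have hφ := double_binomial_sum_zpow hF0 hF1 hF Real.goldenRatio_ne_zero Real.goldenRatio_sq
    m hn k
  have hψ := double_binomial_sum_zpow hF0 hF1 hF Real.goldenConj_ne_zero Real.goldenConj_sq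
    m hn k
  rw [hab m, mul_add, mul_left_comm, mul_left_comm _ b, ← hφ, ← hψ, Finset.mul_sum,
    Finset.mul_sum, ← Finset.sum_add_distrib]
  refine Finset.sum_congr rfl fun j _ => ?_
  rw [Finset.mul_sum, Finset.mul_sum, ← Finset.sum_add_distrib]
  refine Finset.sum_congr rfl fun s _ => ?_
  rw [hab]
  ring
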